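/- arXiv:1702.04083 — 6 statements merged into one kernel-verified Lean document; each statement's English description precedes it below -/
import Mathlib

section
/- For every x ≥ 0 and every real n > 0, one has (1 + x)^(n−1) · (1 + (1 + 2n)x) ≥ 1, with equality if and only if x = 0. (Here powers with real exponent are Real.rpow on the positive base 1 + x.) -/
/-- Key algebraic inequality: for `x ≥ 0` and real `n > 0`,
`(1 + x)^(n-1) * (1 + (1 + 2n) x) ≥ 1`, with equality iff `x = 0`.
Here the power is `Real.rpow` on the positive base `1 + x`. -/
theorem stmt_0 (x n : ℝ) (hx : 0 ≤ x) (hn : 0 < n) :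
    1 ≤ (1 + x) ^ (n - 1) * (1 + (1 + 2 * n) * x) ∧
      ((1 + x) ^ (n - 1) * (1 + (1 + 2 * n) * x) = 1 ↔ x = 0) := by
  rcases hx.eq_or_lt with rfl | hx
  · simp
  have hlt : 1 < (1 + x) ^ (n - 1) * (1 + (1 + 2 * n) * x) :=
    calc 1 < (1 + x) ^ n := Real.one_lt_rpow (by linarith) hn
      _ = (1 + x) ^ (n - 1) * (1 + x) := by
        rw [Real.rpow_sub_one (by positivity), div_mul_cancel₀ _ (by positivity)]
      _ ≤ (1 + x) ^ (n - 1) * (1 + (1 + 2 * n) * x) := by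
        gcongr
        nlinarith [mul_pos hn hx]
  exact ⟨hlt.le, iff_of_false hlt.ne' hx.ne'⟩
end

section
/- The function ε is differentiable on ℝ with derivative ε'(T) = β + α(1 + (γ/2)T²)^(n−1) · (1 + ((1 + 2n)/2)γT²), and ε'(T) > 0 for every real T. -/
/-- The strain–stress function `ε(T) = βT + α(1 + (γ/2)T²)ⁿ T`,
where the power with real exponent `n` is `Real.rpow`. -/
noncomputable def eps (α β γ n : ℝ) : ℝ → ℝ :=
  fun T => β * T + α * (1 + γ / 2 * T ^ 2) ^ n * T

/-- The claimed derivative `ε'(T) = β + α(1 + (γ/2)T²)^(n-1)(1 + ((1+2n)/2)γT²)`. -/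
noncomputable def epsD (α β γ n : ℝ) : ℝ → ℝ :=
  fun T => β + α * (1 + γ / 2 * T ^ 2) ^ (n - 1) * (1 + (1 + 2 * n) / 2 * γ * T ^ 2)

/-- `ε` is differentiable with derivative `ε'` as above, and `ε'(T) > 0` for every `T`. -/
theorem stmt_1 (α β γ n : ℝ) (hα : 0 < α) (hβ : β < 0) (hγ : 0 < γ)
    (hn : 0 < n) (hαβ : 0 < α + β) (T : ℝ) :
    HasDerivAt (eps α β γ n) (epsD α β γ n T) T ∧ 0 < epsD α β γ n T := by
  have hu : 1 ≤ 1 + γ / 2 * T ^ 2 := le_add_of_nonneg_right (by positivity)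
  have hu0 : 0 < 1 + γ / 2 * T ^ 2 := by positivity
  have hpow : (1 + γ / 2 * T ^ 2) ^ n
      = (1 + γ / 2 * T ^ 2) ^ (n - 1) * (1 + γ / 2 * T ^ 2) := by
    rw [← Real.rpow_add_one hu0.ne', sub_add_cancel]
  constructor
  · have hbase : HasDerivAt (fun x : ℝ => 1 + γ / 2 * x ^ 2) (γ * T) T :=
      (((hasDerivAt_pow 2 T).const_mul (γ / 2)).const_add 1).congr_deriv (by norm_num; ring)
    have h := ((hasDerivAt_id' T).const_mul β).add
      (((hbase.rpow_const (p := n) (Or.inl hu0.ne')).const_mul α).mul (hasDerivAt_id' T))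
    refine h.congr_deriv ?_
    simp only [epsD]
    rw [hpow]
    ring
  · have h1 : 1 ≤ (1 + γ / 2 * T ^ 2) ^ n := Real.one_le_rpow hu hn.le
    have h2 : 0 ≤ α * ((1 + γ / 2 * T ^ 2) ^ (n - 1) * (n * γ * T ^ 2)) := by positivity
    have h3 : epsD α β γ n T = β + α * (1 + γ / 2 * T ^ 2) ^ n
        + α * ((1 + γ / 2 * T ^ 2) ^ (n - 1) * (n * γ * T ^ 2)) := by
      simp only [epsD]
      rw [hpow]
      ring
    have h4 : α ≤ α * (1 + γ / 2 * T ^ 2) ^ n := le_mul_of_one_le_right hα.le h1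
    linarith
end

section
/- The function ε is twice differentiable on ℝ with second derivative ε''(T) = αnγT · (3 + ((1 + 2n)/2)γT²) · (1 + (γ/2)T²)^(n−2); consequently ε''(T) > 0 for T > 0, ε''(T) < 0 for T < 0, and ε''(0) = 0, so ε is strictly convex on [0, ∞) and strictly concave on (−∞, 0]. -/
/-- The claimed second derivative
`ε''(T) = α n γ T (3 + ((1+2n)/2)γT²)(1 + (γ/2)T²)^(n-2)`. -/
noncomputable def epsDD (α β γ n : ℝ) : ℝ → ℝ :=
  fun T => α * n * γ * T * (3 + (1 + 2 * n) / 2 * γ * T ^ 2) * (1 + γ / 2 * T ^ 2) ^ (n - 2)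

theorem one_add_half_mul_sq_pos {γ : ℝ} (hγ : 0 < γ) (T : ℝ) : 0 < 1 + γ / 2 * T ^ 2 := by
  positivity

theorem hasDerivAt_one_add_half_mul_sq_rpow {γ : ℝ} (hγ : 0 < γ) (p T : ℝ) :
    HasDerivAt (fun x : ℝ => (1 + γ / 2 * x ^ 2) ^ p)
      (γ * T * p * (1 + γ / 2 * T ^ 2) ^ (p - 1)) T := by
  have h : HasDerivAt (fun x : ℝ => 1 + γ / 2 * x ^ 2) (γ * T) T := by
    refine (((hasDerivAt_pow 2 T).const_mul (γ / 2)).const_add 1).congr_deriv ?_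
    norm_num
    ring
  exact h.rpow_const (Or.inl (one_add_half_mul_sq_pos hγ T).ne')

theorem hasDerivAt_eps (α β n : ℝ) {γ : ℝ} (hγ : 0 < γ) (T : ℝ) :
    HasDerivAt (eps α β γ n)
      (β + α * (1 + γ / 2 * T ^ 2) ^ n +
        α * n * γ * (T ^ 2 * (1 + γ / 2 * T ^ 2) ^ (n - 1))) T := by
  refine (((hasDerivAt_id' T).const_mul β).add
    (((hasDerivAt_one_add_half_mul_sq_rpow hγ n T).const_mul α).mul
      (hasDerivAt_id' T))).congr_deriv ?_
  ring

theorem hasDerivAt_deriv_eps (α β n : ℝ) {γ : ℝ} (hγ : 0 < γ) (T : ℝ) :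
    HasDerivAt (deriv (eps α β γ n)) (epsDD α β γ n T) T := by
  rw [funext fun x => (hasDerivAt_eps α β n hγ x).deriv]
  refine ((((hasDerivAt_one_add_half_mul_sq_rpow hγ n T).const_mul α).const_add β).add
    (((hasDerivAt_pow 2 T).mul
      (hasDerivAt_one_add_half_mul_sq_rpow hγ (n - 1) T)).const_mul (α * n * γ))).congr_deriv ?_
  have hpow : (1 + γ / 2 * T ^ 2) ^ (n - 1) =
      (1 + γ / 2 * T ^ 2) ^ (n - 2) * (1 + γ / 2 * T ^ 2) := by
    rw [← Real.rpow_add_one (one_add_half_mul_sq_pos hγ T).ne']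
    ring_nf
  rw [epsDD, sub_sub, one_add_one_eq_two, hpow]
  norm_num
  ring

theorem epsDD_pos {α γ n : ℝ} (β : ℝ) (hα : 0 < α) (hγ : 0 < γ) (hn : 0 < n) {T : ℝ}
    (hT : 0 < T) : 0 < epsDD α β γ n T := by
  unfold epsDD
  positivity

theorem epsDD_neg_arg (α β γ n T : ℝ) : epsDD α β γ n (-T) = -epsDD α β γ n T := by
  simp only [epsDD, neg_sq]
  ring

theorem epsDD_neg {α γ n : ℝ} (β : ℝ) (hα : 0 < α) (hγ : 0 < γ) (hn : 0 < n) {T : ℝ}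
    (hT : T < 0) : epsDD α β γ n T < 0 := by
  have h := epsDD_pos β hα hγ hn (neg_pos.2 hT)
  rwa [epsDD_neg_arg, neg_pos] at h

/-- `ε` is twice differentiable with second derivative `ε''` as above; `ε'' > 0` on
`(0,∞)`, `ε'' < 0` on `(−∞,0)`, `ε''(0) = 0`, and `ε` is strictly convex on `[0,∞)`
and strictly concave on `(−∞,0]`. -/
theorem stmt_2 (α β γ n : ℝ) (hα : 0 < α) (hβ : β < 0) (hγ : 0 < γ)
    (hn : 0 < n) (hαβ : 0 < α + β) :
    (∀ T : ℝ, DifferentiableAt ℝ (eps α β γ n) T) ∧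
    (∀ T : ℝ, HasDerivAt (deriv (eps α β γ n)) (epsDD α β γ n T) T) ∧
    (∀ T : ℝ, 0 < T → 0 < epsDD α β γ n T) ∧
    (∀ T : ℝ, T < 0 → epsDD α β γ n T < 0) ∧
    epsDD α β γ n 0 = 0 ∧
    StrictConvexOn ℝ (Set.Ici 0) (eps α β γ n) ∧
    StrictConcaveOn ℝ (Set.Iic 0) (eps α β γ n) := by
  have hd (T : ℝ) : DifferentiableAt ℝ (eps α β γ n) T :=
    (hasDerivAt_eps α β n hγ T).differentiableAt
  have hc : Continuous (eps α β γ n) := Differentiable.continuous hd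
  have hdd := hasDerivAt_deriv_eps α β n hγ
  refine ⟨hd, hdd, fun T => epsDD_pos β hα hγ hn, fun T => epsDD_neg β hα hγ hn,
    by simp [epsDD], ?_, ?_⟩
  · refine strictConvexOn_of_deriv2_pos (convex_Ici 0) hc.continuousOn fun T hT => ?_
    rw [interior_Ici] at hT
    simpa [(hdd T).deriv] using epsDD_pos β hα hγ hn hT
  · refine strictConcaveOn_of_deriv2_neg (convex_Iic 0) hc.continuousOn fun T hT => ?_
    rw [interior_Iic] at hT
    simpa [(hdd T).deriv] using epsDD_neg β hα hγ hn hT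
end

section
/- For every real T one has ε'(T) ≥ α + β, with equality if and only if T = 0. Consequently, for any ρ > 0, the forward characteristic speed λ₂(T) = 1/√(ρ ε'(T)) attains a strict global maximum at T = 0, with maximal value 1/√(ρ(α + β)); moreover λ₂ is strictly decreasing on [0, ∞) and strictly increasing on (−∞, 0]. -/
theorem deriv_eps (α β γ n : ℝ) (hγ : 0 < γ) (T : ℝ) :
    deriv (eps α β γ n) T =
      β + α * ((1 + γ / 2 * T ^ 2) ^ n * (1 + 2 * n * (1 - (1 + γ / 2 * T ^ 2)⁻¹))) := by
  have hu : 0 < 1 + γ / 2 * T ^ 2 := by positivity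
  have hbase : HasDerivAt (fun T : ℝ => 1 + γ / 2 * T ^ 2) (γ * T) T := by
    refine (((hasDerivAt_id T).pow 2).const_mul (γ / 2) |>.const_add 1).congr_deriv ?_
    simp only [id_eq, Nat.cast_ofNat, Nat.add_one_sub_one, pow_one, mul_one]
    ring
  have heps := ((hasDerivAt_id T).const_mul β).add
    (((hbase.rpow_const (p := n) (Or.inl hu.ne')).const_mul α).mul (hasDerivAt_id T))
  refine HasDerivAt.deriv (f := eps α β γ n) (heps.congr_deriv ?_)
  rw [Real.rpow_sub_one hu.ne']
  simp only [id_eq]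
  field_simp
  ring

theorem deriv_eps_zero (α β γ n : ℝ) (hγ : 0 < γ) : deriv (eps α β γ n) 0 = α + β := by
  rw [deriv_eps α β γ n hγ]
  simp [add_comm]

theorem deriv_eps_lt_deriv_eps {α β γ n a b : ℝ} (hα : 0 < α) (hγ : 0 < γ) (hn : 0 < n)
    (hab : a ^ 2 < b ^ 2) : deriv (eps α β γ n) a < deriv (eps α β γ n) b := by
  rw [deriv_eps α β γ n hγ, deriv_eps α β γ n hγ]
  have hu : 1 ≤ 1 + γ / 2 * a ^ 2 := le_add_of_nonneg_right (by positivity)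
  have huv : 1 + γ / 2 * a ^ 2 < 1 + γ / 2 * b ^ 2 := by gcongr
  generalize 1 + γ / 2 * a ^ 2 = u at *
  generalize 1 + γ / 2 * b ^ 2 = v at *
  have hu₀ : 0 < u := by linarith
  have hpow : u ^ n < v ^ n := Real.rpow_lt_rpow hu₀.le huv hn
  have hinv : v⁻¹ ≤ u⁻¹ := inv_anti₀ hu₀ huv.le
  have hinv_one : u⁻¹ ≤ 1 := inv_le_one_of_one_le₀ hu
  have hfactor : 0 < 1 + 2 * n * (1 - u⁻¹) := by
    have := mul_nonneg hn.le (sub_nonneg.2 hinv_one)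
    linarith
  have hmono : 1 + 2 * n * (1 - u⁻¹) ≤ 1 + 2 * n * (1 - v⁻¹) := by gcongr
  have hv_pow : 0 ≤ v ^ n := Real.rpow_nonneg (hu₀.trans huv).le n
  gcongr β + α * ?_
  exact mul_lt_mul hpow hmono hfactor hv_pow

/-- `ε'(T) ≥ α + β` with equality iff `T = 0`; hence for `ρ > 0` the forward
characteristic speed `λ₂(T) = 1/√(ρ ε'(T))` attains a strict global maximum at
`T = 0` with value `1/√(ρ(α+β))`, is strictly decreasing on `[0,∞)` and strictly
increasing on `(−∞,0]`. -/
theorem stmt_3 (α β γ n : ℝ) (hα : 0 < α) (hβ : β < 0) (hγ : 0 < γ)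
    (hn : 0 < n) (hαβ : 0 < α + β) :
    (∀ T : ℝ, α + β ≤ deriv (eps α β γ n) T ∧ (deriv (eps α β γ n) T = α + β ↔ T = 0)) ∧
    ∀ ρ : ℝ, 0 < ρ →
      (∀ T : ℝ, T ≠ 0 →
        1 / Real.sqrt (ρ * deriv (eps α β γ n) T) <
          1 / Real.sqrt (ρ * deriv (eps α β γ n) 0)) ∧
      1 / Real.sqrt (ρ * deriv (eps α β γ n) 0) = 1 / Real.sqrt (ρ * (α + β)) ∧
      StrictAntiOn (fun T => 1 / Real.sqrt (ρ * deriv (eps α β γ n) T)) (Set.Ici 0) ∧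
      StrictMonoOn (fun T => 1 / Real.sqrt (ρ * deriv (eps α β γ n) T)) (Set.Iic 0) := by
  have hzero := deriv_eps_zero α β γ n hγ
  have hlt : ∀ T : ℝ, T ≠ 0 → α + β < deriv (eps α β γ n) T := fun T hT =>
    hzero ▸ deriv_eps_lt_deriv_eps hα hγ hn (by simpa [sq_pos_iff] using hT)
  have hle : ∀ T : ℝ, α + β ≤ deriv (eps α β γ n) T := fun T => by
    rcases eq_or_ne T 0 with rfl | hT
    · exact hzero.ge
    · exact (hlt T hT).le
  refine ⟨fun T => ⟨hle T, fun h => ?_, fun h => h ▸ hzero⟩, fun ρ hρ => ?_⟩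
  · by_contra hT
    exact (hlt T hT).ne' h
  have hspeed : ∀ a b : ℝ, a ^ 2 < b ^ 2 →
      1 / Real.sqrt (ρ * deriv (eps α β γ n) b) <
        1 / Real.sqrt (ρ * deriv (eps α β γ n) a) := fun a b hab => by
    have hpos : 0 < ρ * deriv (eps α β γ n) a := mul_pos hρ (hαβ.trans_le (hle a))
    exact one_div_lt_one_div_of_lt (Real.sqrt_pos.2 hpos) (Real.sqrt_lt_sqrt hpos.le
      (mul_lt_mul_of_pos_left (deriv_eps_lt_deriv_eps hα hγ hn hab) hρ))
  refine ⟨fun T hT => hspeed 0 T (by simpa [sq_pos_iff] using hT), by rw [hzero], ?_, ?_⟩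
  · intro a ha b _ hab
    exact hspeed a b (pow_lt_pow_left₀ hab ha two_ne_zero)
  · intro a _ b hb hab
    exact hspeed b a (sq_lt_sq.2 (by
      rw [abs_of_nonpos hb, abs_of_neg (hab.trans_le hb)]
      exact neg_lt_neg hab))
end

section
/- (Closed form of the driving force.) For all real T_l, T_r, the driving force f(T_l, T_r) = ∫_{T_r}^{T_l} ε(y) dy + ((ε(T_r) + ε(T_l))/2)·(T_r − T_l) satisfies f(T_l, T_r) = (α/((n+1)γ)) · [F(T_l, T_r) − F(T_r, T_l)], where F(x, y) = (1 + (γ/2)x²)ⁿ · (1 − (n/2)γx² + ((n+1)/2)γxy). -/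
/-- `F(x,y) = (1 + (γ/2)x²)ⁿ (1 − (n/2)γx² + ((n+1)/2)γxy)`. -/
noncomputable def Fdf (γ n x y : ℝ) : ℝ :=
  (1 + γ / 2 * x ^ 2) ^ n * (1 - n / 2 * γ * x ^ 2 + (n + 1) / 2 * γ * x * y)

/-- An antiderivative of the strain–stress function. -/
theorem hasDerivAt_eps_primitive (α β : ℝ) {γ n : ℝ} (hγ : 0 < γ) (hn : n + 1 ≠ 0) (y : ℝ) :
    HasDerivAt (fun T : ℝ => β / 2 * T ^ 2 +
      α / ((n + 1) * γ) * (1 + γ / 2 * T ^ 2) ^ (n + 1)) (eps α β γ n y) y := by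
  have hpos : 0 < 1 + γ / 2 * y ^ 2 := by positivity
  have hbase : HasDerivAt (fun T : ℝ => 1 + γ / 2 * T ^ 2) (γ * y) y := by
    refine (((hasDerivAt_pow 2 y).const_mul (γ / 2)).const_add 1).congr_deriv ?_
    norm_num
    ring
  have hrpow := hbase.rpow_const (p := n + 1) (Or.inl hpos.ne')
  refine (((hasDerivAt_pow 2 y).const_mul (β / 2)).add
    (hrpow.const_mul (α / ((n + 1) * γ)))).congr_deriv ?_
  simp only [eps, add_sub_cancel_right]
  norm_num
  field_simp

theorem continuous_eps (α β : ℝ) {γ : ℝ} (hγ : 0 < γ) (n : ℝ) : Continuous (eps α β γ n) := by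
  have hpow : Continuous fun T : ℝ => (1 + γ / 2 * T ^ 2) ^ n :=
    Continuous.rpow_const (by fun_prop) fun T => Or.inl (by positivity)
  unfold eps
  fun_prop

/-- Closed form of the driving force:
`f(T_l,T_r) = ∫_{T_r}^{T_l} ε + ((ε(T_r)+ε(T_l))/2)(T_r − T_l)
            = (α/((n+1)γ)) (F(T_l,T_r) − F(T_r,T_l))`. -/
theorem stmt_8 (α β γ n : ℝ) (hα : 0 < α) (hβ : β < 0) (hγ : 0 < γ)
    (hn : 0 < n) (hαβ : 0 < α + β) (Tl Tr : ℝ) :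
    (∫ y in Tr..Tl, eps α β γ n y) +
        (eps α β γ n Tr + eps α β γ n Tl) / 2 * (Tr - Tl) =
      α / ((n + 1) * γ) * (Fdf γ n Tl Tr - Fdf γ n Tr Tl) := by
  have hn1 : n + 1 ≠ 0 := by positivity
  rw [intervalIntegral.integral_eq_sub_of_hasDerivAt
    (fun y _ => hasDerivAt_eps_primitive α β hγ hn1 y)
    ((continuous_eps α β hγ n).intervalIntegrable Tr Tl)]
  have hl : 0 < 1 + γ / 2 * Tl ^ 2 := by positivity
  have hr : 0 < 1 + γ / 2 * Tr ^ 2 := by positivity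
  simp only [eps, Fdf, Real.rpow_add_one hl.ne', Real.rpow_add_one hr.ne']
  generalize (1 + γ / 2 * Tl ^ 2) ^ n = L
  generalize (1 + γ / 2 * Tr ^ 2) ^ n = R
  field_simp
  ring
end

section
/- (Second-order contact of the backward shock and rarefaction curves at the tangency point.) Let ρ > 0, T_l < 0, v_l ∈ ℝ, and let T₂ > 0 be the unique solution of ε(T₂) − ε(T_l) = ε'(T₂)(T₂ − T_l) with T₂ > T_l. Set v₂ = v_l + (T₂ − T_l)√(ε'(T₂)/ρ), and define S(T) = v_l + √((T − T_l)(ε(T) − ε(T_l))/ρ) for T ∈ (T_l, T₂] and R(T) = v₂ + ∫_{T₂}^{T} √(ε'(τ)/ρ) dτ for T ≥ T₂. Then S(T₂) = R(T₂) = v₂, the derivatives satisfy lim_{T→T₂} S'(T) = lim_{T→T₂} R'(T) = √(ε'(T₂)/ρ), and the second derivatives satisfy lim_{T→T₂} S''(T) = lim_{T→T₂} R''(T) = ε''(T₂)/(2√(ρ ε'(T₂))). Hence the shock wave curve S₁ and the rarefaction wave curve R₁ have second-order contact at the point (T₂, v₂). -/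
/-- The backward shock curve `S(T) = v_l + √((T − T_l)(ε(T) − ε(T_l))/ρ)`. -/
noncomputable def shockCurve (α β γ n ρ Tl vl : ℝ) : ℝ → ℝ :=
  fun T => vl + Real.sqrt ((T - Tl) * (eps α β γ n T - eps α β γ n Tl) / ρ)

/-- The backward rarefaction curve `R(T) = v₂ + ∫_{T₂}^{T} √(ε'(τ)/ρ) dτ`. -/
noncomputable def rareCurve (α β γ n ρ T₂ v₂ : ℝ) : ℝ → ℝ :=
  fun T => v₂ + ∫ τ in T₂..T, Real.sqrt (deriv (eps α β γ n) τ / ρ)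

theorem ContDiffAt.continuousAt_deriv_deriv {f : ℝ → ℝ} {x : ℝ} (hf : ContDiffAt ℝ 2 f x) :
    ContinuousAt (deriv f) x ∧ ContinuousAt (deriv (deriv f)) x := by
  have h₁ : ContDiffAt ℝ 1 (deriv f) x := hf.derivWithin (by norm_num)
  have h₀ : ContDiffAt ℝ 0 (deriv (deriv f)) x := h₁.derivWithin (by norm_num)
  exact ⟨h₁.continuousAt, h₀.continuousAt⟩

theorem deriv_deriv_sqrt {f : ℝ → ℝ} {x : ℝ} (hf : ContDiffAt ℝ 2 f x) (hx : 0 < f x) :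
    deriv (deriv fun y => √(f y)) x =
      deriv (deriv f) x / (2 * √(f x)) - deriv f x ^ 2 / (4 * √(f x) ^ 3) := by
  have hev : (deriv fun y => √(f y)) =ᶠ[nhds x] fun y => deriv f y / (2 * √(f y)) := by
    filter_upwards [hf.eventually (by decide), hf.continuousAt.eventually_ne hx.ne']
      with y hy hy₀
    exact deriv_sqrt (hy.differentiableAt (by norm_num)) hy₀
  have h₁ : ContDiffAt ℝ 1 (deriv f) x := hf.derivWithin (by norm_num)
  have hd : HasDerivAt (fun y => √(f y)) (deriv f x / (2 * √(f x))) x :=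
    (hf.differentiableAt (by norm_num)).hasDerivAt.sqrt hx.ne'
  have hs : 0 < √(f x) := Real.sqrt_pos.2 hx
  rw [hev.deriv_eq]
  refine ((h₁.differentiableAt one_ne_zero).hasDerivAt.div (hd.const_mul 2)
    (by positivity)).deriv.trans ?_
  field_simp
  ring

theorem contDiff_eps {α β γ n : ℝ} (hγ : 0 < γ) : ContDiff ℝ 2 (eps α β γ n) := by
  have hpow : ContDiff ℝ 2 fun T : ℝ => (1 + γ / 2 * T ^ 2) ^ n :=
    ContDiff.rpow_const_of_ne (by fun_prop) fun T => (one_add_half_mul_sq_pos hγ T).ne'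
  unfold eps
  fun_prop

theorem deriv_eps_pos {α β γ n : ℝ} (hα : 0 < α) (hγ : 0 < γ) (hn : 0 < n)
    (hαβ : 0 < α + β) (T : ℝ) : 0 < deriv (eps α β γ n) T := by
  have hu := one_add_half_mul_sq_pos hγ T
  have hbase : HasDerivAt (fun T : ℝ => 1 + γ / 2 * T ^ 2) (γ * T) T :=
    (((hasDerivAt_pow 2 T).const_mul (γ / 2)).const_add 1).congr_deriv (by norm_num; ring)
  have hd : HasDerivAt (eps α β γ n)
      (β + α * (1 + γ / 2 * T ^ 2) ^ n +
        α * n * γ * T ^ 2 * (1 + γ / 2 * T ^ 2) ^ (n - 1)) T :=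
    (((hasDerivAt_id T).const_mul β).add
      (((hbase.rpow_const (p := n) (Or.inl hu.ne')).const_mul α).mul
        (hasDerivAt_id T))).congr_deriv (by simp only [id]; ring)
  rw [hd.deriv]
  have hone : 1 ≤ (1 + γ / 2 * T ^ 2) ^ n :=
    Real.one_le_rpow (le_add_of_nonneg_right (by positivity)) hn.le
  have hrest : 0 ≤ α * n * γ * T ^ 2 * (1 + γ / 2 * T ^ 2) ^ (n - 1) := by positivity
  nlinarith [mul_le_mul_of_nonneg_left hone hα.le]

/-- The value and first two derivatives of `T ↦ (T - a) * (e T - e a) / ρ` at a point `x` where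
the secant from `a` is tangent to the graph of `e`. -/
theorem secant_product_derivs {e : ℝ → ℝ} (he : ContDiff ℝ 2 e) (a ρ x : ℝ)
    (htan : e x - e a = deriv e x * (x - a)) :
    (x - a) * (e x - e a) / ρ = (x - a) ^ 2 * (deriv e x / ρ) ∧
    deriv (fun T => (T - a) * (e T - e a) / ρ) x = 2 * (x - a) * (deriv e x / ρ) ∧
    deriv (deriv fun T => (T - a) * (e T - e a) / ρ) x =
      (2 * deriv e x + (x - a) * deriv (deriv e) x) / ρ := by
  have hd : ∀ T, HasDerivAt e (deriv e T) T := fun T =>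
    (he.differentiable (by norm_num) T).hasDerivAt
  have hdd : HasDerivAt (deriv e) (deriv (deriv e) x) x :=
    (he.differentiable_deriv_two x).hasDerivAt
  have hsub : ∀ T, HasDerivAt (fun T : ℝ => T - a) 1 T := fun T =>
    (hasDerivAt_id T).sub_const a
  have hprod : (deriv fun T => (T - a) * (e T - e a) / ρ) =
      fun T => ((e T - e a) + (T - a) * deriv e T) / ρ := by
    funext T
    exact (((hsub T).mul ((hd T).sub_const (e a))).div_const ρ).deriv.trans (by rw [one_mul])
  refine ⟨by rw [htan]; ring, by rw [hprod]; simp only [htan]; ring, ?_⟩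
  rw [hprod]
  exact ((((hd x).sub_const (e a)).add ((hsub x).mul hdd)).div_const ρ).deriv.trans (by ring)

/-- Second-order contact of the backward shock and rarefaction curves at the
tangency point `(T₂, v₂)`: the curves agree there, and their first and second
derivatives have equal limits at `T₂`, namely `√(ε'(T₂)/ρ)` and
`ε''(T₂)/(2√(ρ ε'(T₂)))` respectively. -/
theorem stmt_13 (α β γ n ρ Tl vl T₂ : ℝ) (hα : 0 < α) (hβ : β < 0) (hγ : 0 < γ)
    (hn : 0 < n) (hαβ : 0 < α + β) (hρ : 0 < ρ) (hTl : Tl < 0)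
    (hT₂pos : 0 < T₂) (hT₂gt : Tl < T₂)
    (htan : eps α β γ n T₂ - eps α β γ n Tl = deriv (eps α β γ n) T₂ * (T₂ - Tl)) :
    shockCurve α β γ n ρ Tl vl T₂ =
        vl + (T₂ - Tl) * Real.sqrt (deriv (eps α β γ n) T₂ / ρ) ∧
    rareCurve α β γ n ρ T₂ (vl + (T₂ - Tl) * Real.sqrt (deriv (eps α β γ n) T₂ / ρ)) T₂ =
        vl + (T₂ - Tl) * Real.sqrt (deriv (eps α β γ n) T₂ / ρ) ∧
    Filter.Tendsto (deriv (shockCurve α β γ n ρ Tl vl))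
      (nhdsWithin T₂ (Set.Ioo Tl T₂))
      (nhds (Real.sqrt (deriv (eps α β γ n) T₂ / ρ))) ∧
    Filter.Tendsto
      (deriv (rareCurve α β γ n ρ T₂ (vl + (T₂ - Tl) * Real.sqrt (deriv (eps α β γ n) T₂ / ρ))))
      (nhdsWithin T₂ (Set.Ioi T₂))
      (nhds (Real.sqrt (deriv (eps α β γ n) T₂ / ρ))) ∧
    Filter.Tendsto (deriv (deriv (shockCurve α β γ n ρ Tl vl)))
      (nhdsWithin T₂ (Set.Ioo Tl T₂))
      (nhds (deriv (deriv (eps α β γ n)) T₂ /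
        (2 * Real.sqrt (ρ * deriv (eps α β γ n) T₂)))) ∧
    Filter.Tendsto
      (deriv (deriv (rareCurve α β γ n ρ T₂ (vl + (T₂ - Tl) * Real.sqrt (deriv (eps α β γ n) T₂ / ρ)))))
      (nhdsWithin T₂ (Set.Ioi T₂))
      (nhds (deriv (deriv (eps α β γ n)) T₂ /
        (2 * Real.sqrt (ρ * deriv (eps α β γ n) T₂)))) := by
  have he : ContDiff ℝ 2 (eps α β γ n) := contDiff_eps hγ
  have hpos : ∀ T, 0 < deriv (eps α β γ n) T := deriv_eps_pos hα hγ hn hαβ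
  unfold shockCurve rareCurve
  generalize eps α β γ n = e at *
  have hd : 0 < T₂ - Tl := sub_pos.2 hT₂gt
  have hsq : ∀ T, 0 < deriv e T / ρ := fun T => div_pos (hpos T) hρ
  have hs : 0 < √(deriv e T₂ / ρ) := Real.sqrt_pos.2 (hsq T₂)
  have hs_sq : √(deriv e T₂ / ρ) ^ 2 = deriv e T₂ / ρ := Real.sq_sqrt (hsq T₂).le
  have hρs : √(ρ * deriv e T₂) = ρ * √(deriv e T₂ / ρ) := by
    rw [show ρ * deriv e T₂ = ρ ^ 2 * (deriv e T₂ / ρ) by field_simp,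
      Real.sqrt_mul (sq_nonneg ρ), Real.sqrt_sq hρ.le]
  obtain ⟨hF₀, hF₁, hF₂⟩ := secant_product_derivs he Tl ρ T₂ htan
  have hF : ContDiff ℝ 2 fun T => (T - Tl) * (e T - e Tl) / ρ := by fun_prop
  have hFpos : 0 < (T₂ - Tl) * (e T₂ - e Tl) / ρ := by
    rw [hF₀]
    exact mul_pos (pow_pos hd 2) (hsq T₂)
  have hsqrt : √((T₂ - Tl) * (e T₂ - e Tl) / ρ) = (T₂ - Tl) * √(deriv e T₂ / ρ) := by
    rw [hF₀, Real.sqrt_mul (sq_nonneg _), Real.sqrt_sq hd.le]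
  have hS := (hF.contDiffAt.sqrt hFpos.ne').continuousAt_deriv_deriv
  have hS_deriv : (deriv fun T => vl + √((T - Tl) * (e T - e Tl) / ρ)) =
      deriv fun T => √((T - Tl) * (e T - e Tl) / ρ) := by
    funext T
    rw [deriv_const_add]
  have he' : ContDiff ℝ 1 (deriv e) := he.deriv'
  have hslope : Continuous fun T => √(deriv e T / ρ) :=
    (he'.continuous.div_const ρ).sqrt
  have hslope_diff : ContDiff ℝ 1 fun T => √(deriv e T / ρ) :=
    (he'.div_const ρ).sqrt fun T => (hsq T).ne'
  have hR : ∀ v, (deriv fun T => v + ∫ τ in T₂..T, √(deriv e τ / ρ)) =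
      fun T => √(deriv e T / ρ) := fun v => by
    funext T
    rw [deriv_const_add, hslope.deriv_integral]
  refine ⟨by rw [hsqrt], by simp, ?_, ?_, ?_, ?_⟩
  · have hval : deriv (fun T => √((T - Tl) * (e T - e Tl) / ρ)) T₂ = √(deriv e T₂ / ρ) := by
      rw [deriv_sqrt (hF.differentiable (by norm_num) T₂) hFpos.ne', hF₁, hsqrt,
        div_eq_iff (by positivity)]
      linear_combination -2 * (T₂ - Tl) * hs_sq
    rw [hS_deriv, ← hval]
    exact hS.1.tendsto.mono_left nhdsWithin_le_nhds
  · rw [hR]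
    exact hslope.continuousAt.tendsto.mono_left nhdsWithin_le_nhds
  · have hval : deriv (deriv fun T => √((T - Tl) * (e T - e Tl) / ρ)) T₂ =
        deriv (deriv e) T₂ / (2 * √(ρ * deriv e T₂)) := by
      have ha : deriv e T₂ = ρ * √(deriv e T₂ / ρ) ^ 2 := by
        rw [hs_sq]
        field_simp
      rw [deriv_deriv_sqrt hF.contDiffAt hFpos, hF₁, hF₂, hsqrt, hρs]
      generalize √(deriv e T₂ / ρ) = s at *
      rw [ha]
      field_simp
      ring
    rw [hS_deriv, ← hval]
    exact hS.2.tendsto.mono_left nhdsWithin_le_nhds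
  · have hval : deriv (fun T => √(deriv e T / ρ)) T₂ =
        deriv (deriv e) T₂ / (2 * √(ρ * deriv e T₂)) := by
      rw [deriv_sqrt ((he'.differentiable one_ne_zero).div_const ρ T₂) (hsq T₂).ne', hρs,
        deriv_div_const]
      field_simp
    rw [hR, ← hval]
    exact (hslope_diff.continuous_deriv le_rfl).continuousAt.tendsto.mono_left
      nhdsWithin_le_nhds
end
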